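/- Every balanced split graph has a unique KS-partition: if G is a balanced split graph and (A,B) and (A',B') are both KS-partitions of G, then A = A' and B = B'. -/

import Mathlib

namespace Tysh

open SimpleGraph

variable {V : Type}

/-- A set of vertices is independent (stable). -/
def IsIndep (G : SimpleGraph V) (s : Set V) : Prop :=
  ∀ ⦃u⦄, u ∈ s → ∀ ⦃v⦄, v ∈ s → u ≠ v → ¬ G.Adj u v

/-- `(A, B)` is a KS-partition of `G`: `A` induces a clique, `B` an independent set,
and they partition the vertex set. -/
def IsKSPartition (G : SimpleGraph V) (A B : Set V) : Prop :=
  G.IsClique A ∧ IsIndep G B ∧ A ∪ B = Set.univ ∧ Disjoint A B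

/-- A split graph is one admitting a KS-partition. -/
def IsSplit (G : SimpleGraph V) : Prop := ∃ A B, IsKSPartition G A B

/-- Independence number. -/
noncomputable def indepNum (G : SimpleGraph V) : ℕ := Gᶜ.cliqueNum

/-- `G` is decomposable: its vertices can be partitioned into `A ∪ B` (a nonempty split
graph with KS-partition `(A,B)`) and a nonempty part `W`, with all `A`–`W` edges present
and no `B`–`W` edges; i.e. `G` is (isomorphic to) the composition `(G[A∪B],A,B) ∘ G[W]`. -/
def Decomposable (G : SimpleGraph V) : Prop :=
  ∃ A B W : Set V,
    (A ∪ B) ∪ W = Set.univ ∧ Disjoint A B ∧ Disjoint (A ∪ B) W ∧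
    (A ∪ B).Nonempty ∧ W.Nonempty ∧
    G.IsClique A ∧ IsIndep G B ∧
    (∀ a ∈ A, ∀ w ∈ W, G.Adj a w) ∧
    (∀ b ∈ B, ∀ w ∈ W, ¬ G.Adj b w)

/-- The composition `(G,A,B) ∘ H` of a split graph `G` (with clique part `A`)
with a graph `H`. -/
def comp {α β : Type} (G : SimpleGraph α) (A : Set α) (H : SimpleGraph β) :
    SimpleGraph (α ⊕ β) :=
  SimpleGraph.fromRel (fun x y =>
    match x, y with
    | .inl a, .inl a' => G.Adj a a'
    | .inr b, .inr b' => H.Adj b b'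
    | .inl a, .inr _ => a ∈ A
    | .inr _, .inl _ => False)

/-- The iterated composition `(G_k,A_k,B_k) ∘ ⋯ ∘ (G_1,A_1,B_1) ∘ G_0`
(component `0` is `G_0`; the clique part `A i` of component `i` is joined to
all components with smaller index). -/
def iterComp {k : ℕ} {Vi : Fin (k+1) → Type} (Gi : ∀ i, SimpleGraph (Vi i))
    (A : ∀ i, Set (Vi i)) : SimpleGraph (Σ i, Vi i) :=
  SimpleGraph.fromRel (fun x y =>
    (∃ h : x.1 = y.1, (Gi y.1).Adj (h ▸ x.2) y.2) ∨ (y.1 < x.1 ∧ x.2 ∈ A x.1))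

/-- The multiset of vertex degrees of a finite graph. -/
noncomputable def degMultiset {V : Type} [Fintype V] (G : SimpleGraph V) : Multiset ℕ :=
  Finset.univ.val.map fun v => (G.neighborSet v).ncard

/-- A unigraph is a graph determined up to isomorphism by its degree sequence. -/
def Unigraph {V : Type} [Fintype V] (G : SimpleGraph V) : Prop :=
  ∀ (W : Type) [Fintype W] (H : SimpleGraph W),
    degMultiset G = degMultiset H → Nonempty (G ≃g H)


theorem exists_not_adj_of_ncard_eq_cliqueNum {V : Type} [Finite V] {G : SimpleGraph V}
    {s : Set V} (hs : G.IsClique s) (hcard : s.ncard = G.cliqueNum) {x : V} (hx : x ∉ s) :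
    ∃ a ∈ s, ¬ G.Adj x a := by
  classical
  have := Fintype.ofFinite V
  by_contra! hadj
  have hins : G.IsClique ((insert x s).toFinset : Set V) := by
    rw [Set.coe_toFinset]
    exact hs.insert fun b hb _ => hadj b hb
  have hle := hins.card_le_cliqueNum
  rw [← Set.ncard_eq_toFinset_card', Set.ncard_insert_of_notMem hx] at hle
  omega

theorem IsIndep.isClique_compl {V : Type} {G : SimpleGraph V} {s : Set V}
    (hs : IsIndep G s) : Gᶜ.IsClique s :=
  fun _ hu _ hv huv => (SimpleGraph.compl_adj _ _ _).2 ⟨huv, hs hu hv huv⟩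

theorem exists_adj_of_ncard_eq_indepNum {V : Type} [Finite V] {G : SimpleGraph V}
    {s : Set V} (hs : IsIndep G s) (hcard : s.ncard = indepNum G) {x : V} (hx : x ∉ s) :
    ∃ b ∈ s, G.Adj x b := by
  obtain ⟨b, hb, hxb⟩ := exists_not_adj_of_ncard_eq_cliqueNum hs.isClique_compl hcard hx
  have hne : x ≠ b := fun h => hx (h ▸ hb)
  exact ⟨b, hb, by simpa [SimpleGraph.compl_adj, hne] using hxb⟩

theorem IsKSPartition.mem_right_iff {V : Type} {G : SimpleGraph V} {A B : Set V}
    (h : IsKSPartition G A B) {x : V} : x ∈ B ↔ x ∉ A := by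
  obtain ⟨-, -, hcover, hdisj⟩ := h
  exact ⟨fun hB hA => Set.disjoint_left.1 hdisj hA hB,
    ((Set.ext_iff.1 hcover x).2 trivial).resolve_left⟩

theorem IsKSPartition.eq_of_balanced {V : Type} [Finite V] {G : SimpleGraph V}
    {A₀ B₀ A B : Set V} (h₀ : IsKSPartition G A₀ B₀) (hA₀ : A₀.ncard = G.cliqueNum)
    (hB₀ : B₀.ncard = indepNum G) (h : IsKSPartition G A B) : A = A₀ ∧ B = B₀ := by
  have hmem : ∀ x, x ∈ B ↔ x ∉ A := fun _ => h.mem_right_iff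
  have hmem₀ : ∀ x, x ∈ B₀ ↔ x ∉ A₀ := fun _ => h₀.mem_right_iff
  have hA : A = A₀ := by
    refine Set.Subset.antisymm (fun x hx => ?_) (fun x hx => ?_)
    · by_contra hx₀
      obtain ⟨y, hy₀, hxy⟩ := exists_not_adj_of_ncard_eq_cliqueNum h₀.1 hA₀ hx₀
      have hy : y ∉ A := fun hy => hxy (h.1 hx hy fun e => hx₀ (e ▸ hy₀))
      obtain ⟨b, hb₀, hyb⟩ :=
        exists_adj_of_ncard_eq_indepNum h₀.2.1 hB₀ (x := y) (by simpa [hmem₀] using hy₀)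
      have hb : b ∈ A := by
        by_contra hb
        exact h.2.1 ((hmem y).2 hy) ((hmem b).2 hb) hyb.ne hyb
      have hxb : x ≠ b := fun e => hxy (e ▸ hyb.symm)
      exact h₀.2.1 ((hmem₀ x).2 hx₀) hb₀ hxb (h.1 hx hb hxb)
    · by_contra hxA
      obtain ⟨b, hb₀, hxb⟩ :=
        exists_adj_of_ncard_eq_indepNum h₀.2.1 hB₀ (x := x) (by simpa [hmem₀] using hx)
      have hb : b ∈ A := by
        by_contra hb
        exact h.2.1 ((hmem x).2 hxA) ((hmem b).2 hb) hxb.ne hxb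
      obtain ⟨a, ha₀, hba⟩ :=
        exists_not_adj_of_ncard_eq_cliqueNum h₀.1 hA₀ ((hmem₀ b).1 hb₀)
      have ha : a ∉ A := fun ha => hba (h.1 hb ha fun e => (hmem₀ b).1 hb₀ (e ▸ ha₀))
      have hxa : x ≠ a := fun e => hba (e ▸ hxb.symm)
      exact h.2.1 ((hmem x).2 hxA) ((hmem a).2 ha) hxa (h₀.1 hx ha₀ hxa)
  refine ⟨hA, Set.ext fun x => ?_⟩
  rw [hmem, hmem₀, hA]

/-- A balanced split graph has a unique KS-partition. -/
theorem balanced_unique_KSPartition {V : Type} [Fintype V] (G : SimpleGraph V)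
    (hbal : ∃ A₀ B₀, IsKSPartition G A₀ B₀ ∧
      A₀.ncard = G.cliqueNum ∧ B₀.ncard = indepNum G)
    (A B A' B' : Set V) (h : IsKSPartition G A B) (h' : IsKSPartition G A' B') :
    A = A' ∧ B = B' := by
  obtain ⟨A₀, B₀, h₀, hA₀, hB₀⟩ := hbal
  obtain ⟨rfl, rfl⟩ := h₀.eq_of_balanced hA₀ hB₀ h
  obtain ⟨rfl, rfl⟩ := h₀.eq_of_balanced hA₀ hB₀ h'
  exact ⟨rfl, rfl⟩

end Tysh
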